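/- arXiv:1809.00752 — 2 statements merged into one kernel-verified Lean document; each statement's English description precedes it below -/
import Mathlib

section
/- Every row sum of the Jacobian matrix of the Arimoto map at the capacity-achieving distribution is zero: for every i' ∈ {1,…,m}, Σ_{i=1}^m ∂F_i/∂λ_{i'}(λ*) = 0, where the partial derivatives are taken treating λ_1,…,λ_m as independent variables on the open set U = {λ ∈ ℝ^m : (λΦ)_j > 0 for all j}. (Lemma on row sums of J(λ*)) -/
open scoped BigOperators

noncomputable section

/-- The simplex of probability vectors on `Fin m`. -/
def chSimplex (m : ℕ) : Set (Fin m → ℝ) :=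
  {l | (∀ i, 0 ≤ l i) ∧ ∑ i, l i = 1}

/-- The output distribution `λΦ` of the channel `P` for input distribution `l`. -/
def chOut {m n : ℕ} (P : Matrix (Fin m) (Fin n) ℝ) (l : Fin m → ℝ) (j : Fin n) : ℝ :=
  ∑ i, l i * P i j

/-- Kullback-Leibler divergence `D(Q‖Q')`. -/
def chKL {n : ℕ} (Q Q' : Fin n → ℝ) : ℝ :=
  ∑ j, Q j * Real.log (Q j / Q' j)

/-- Mutual information `I(λ,Φ)`. -/
def chMI {m n : ℕ} (P : Matrix (Fin m) (Fin n) ℝ) (l : Fin m → ℝ) : ℝ :=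
  ∑ i, ∑ j, l i * P i j * Real.log (P i j / chOut P l j)

/-- The Arimoto map `F(λ)`, componentwise. -/
def chAF {m n : ℕ} (P : Matrix (Fin m) (Fin n) ℝ) (l : Fin m → ℝ) (i : Fin m) : ℝ :=
  l i * Real.exp (chKL (P i) (chOut P l)) /
    ∑ k, l k * Real.exp (chKL (P k) (chOut P l))

/-- Partial derivative `∂f/∂λ_{i'}` at `x`, treating the coordinates as
independent variables. -/
def chPd {m : ℕ} (f : (Fin m → ℝ) → ℝ) (i' : Fin m) (x : Fin m → ℝ) : ℝ :=
  fderiv ℝ f x (Pi.single i' 1)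

/-- Second partial derivative `∂²f/∂λ_{i'}∂λ_{i''}` at `x`. -/
def chPd2 {m : ℕ} (f : (Fin m → ℝ) → ℝ) (i' i'' : Fin m) (x : Fin m → ℝ) : ℝ :=
  chPd (chPd f i'') i' x

theorem differentiableAt_div_of_ne_zero {E : Type*} [NormedAddCommGroup E] [NormedSpace ℝ E]
    {f g : E → ℝ} {x : E} (hf : DifferentiableAt ℝ f x) (hg : DifferentiableAt ℝ g x)
    (hx : g x ≠ 0) : DifferentiableAt ℝ (fun y => f y / g y) x := by
  simp only [div_eq_mul_inv]
  exact hf.mul (hg.inv hx)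

theorem differentiable_chOut {m n : ℕ} (P : Matrix (Fin m) (Fin n) ℝ) (j : Fin n) :
    Differentiable ℝ (fun l => chOut P l j) := by
  unfold chOut
  fun_prop

theorem differentiableAt_chKL {m n : ℕ} {P : Matrix (Fin m) (Fin n) ℝ} {l : Fin m → ℝ}
    (hl : ∀ j, 0 < chOut P l j) (i : Fin m) :
    DifferentiableAt ℝ (fun x => chKL (P i) (chOut P x)) l := by
  unfold chKL
  refine DifferentiableAt.fun_sum fun j _ => ?_
  by_cases h : P i j = 0
  · simp [h]
  · exact ((differentiableAt_div_of_ne_zero (differentiableAt_const _) (differentiable_chOut P j l) (hl j).ne').log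
      (div_ne_zero h (hl j).ne')).const_mul _

theorem differentiableAt_chAF_numerator {m n : ℕ} {P : Matrix (Fin m) (Fin n) ℝ}
    {l : Fin m → ℝ} (hl : ∀ j, 0 < chOut P l j) (i : Fin m) :
    DifferentiableAt ℝ (fun x => x i * Real.exp (chKL (P i) (chOut P x))) l :=
  (differentiableAt_apply i l).mul (differentiableAt_chKL hl i).exp

theorem chAF_denominator_pos {m n : ℕ} (P : Matrix (Fin m) (Fin n) ℝ) {l : Fin m → ℝ}
    (hl : l ∈ chSimplex m) : 0 < ∑ k, l k * Real.exp (chKL (P k) (chOut P l)) := by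
  have hpos : ∃ i ∈ Finset.univ, 0 < l i := by
    refine Finset.exists_lt_of_sum_lt ?_
    simp [hl.2]
  obtain ⟨i, hi, hli⟩ := hpos
  exact Finset.sum_pos' (fun k _ => mul_nonneg (hl.1 k) (Real.exp_pos _).le)
    ⟨i, hi, mul_pos hli (Real.exp_pos _)⟩

/-- Every row sum of the Jacobian matrix of the Arimoto map at the
capacity-achieving distribution is zero. -/
theorem stmt_2 (m n : ℕ) (P : Matrix (Fin m) (Fin n) ℝ)
    (hPnn : ∀ i j, 0 ≤ P i j) (hProw : ∀ i, ∑ j, P i j = 1)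
    (hPcol : ∀ j, ∃ i, 0 < P i j)
    (C : ℝ) (hub : ∀ l ∈ chSimplex m, chMI P l ≤ C)
    (lstar : Fin m → ℝ) (hls : lstar ∈ chSimplex m) (hach : chMI P lstar = C)
    (hQpos : ∀ j, 0 < chOut P lstar j) :
    ∀ i' : Fin m, ∑ i, chPd (fun x => chAF P x i) i' lstar = 0 := by
  intro i'
  have hden : DifferentiableAt ℝ
      (fun x : Fin m → ℝ => ∑ k, x k * Real.exp (chKL (P k) (chOut P x))) lstar :=
    DifferentiableAt.fun_sum fun k _ => differentiableAt_chAF_numerator hQpos k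
  have hpos := chAF_denominator_pos P hls
  have hF : ∀ i, DifferentiableAt ℝ (fun x => chAF P x i) lstar := fun i =>
    differentiableAt_div_of_ne_zero (differentiableAt_chAF_numerator hQpos i) hden hpos.ne'
  have hsum : (fun x => ∑ i, chAF P x i) =ᶠ[nhds lstar] fun _ => (1 : ℝ) := by
    filter_upwards [hden.continuousAt.eventually_ne hpos.ne'] with x hx
    unfold chAF
    rw [← Finset.sum_div, div_self hx]
  have hderiv := hsum.fderiv_eq (𝕜 := ℝ)
  rw [fderiv_fun_sum fun i _ => hF i] at hderiv
  simpa [chPd] using congrArg (fun L => L (Pi.single i' 1)) hderiv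
end
end

section
/- Let λ* ∈ Δ(X) achieve the channel capacity C, with Q* = λ*Φ and Q*_j > 0 for all j. Write D*_i = D(P^i‖Q*) and D*_{i',i} = −Σ_{j=1}^n P^{i'}_j P^i_j / Q*_j. Then, treating λ_1,…,λ_m as independent variables on the open set U = {λ ∈ ℝ^m : (λΦ)_j > 0 for all j}, the partial derivatives of the Arimoto map at λ* are: ∂F_i/∂λ_{i'}(λ*) = e^{D*_i − C}(δ_{i'i} + λ*_i D*_{i',i}) + λ*_i (1 − e^{D*_{i'} − C}) for all i', i ∈ {1,…,m}, where δ_{i'i} is the Kronecker delta. (Theorem 1) -/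
open scoped BigOperators

noncomputable section

/-- The output distribution at symbol `j`, as a continuous linear functional of the input. -/
def chOutCLM {m n : ℕ} (P : Matrix (Fin m) (Fin n) ℝ) (j : Fin n) : (Fin m → ℝ) →L[ℝ] ℝ :=
  ∑ i, P i j • ContinuousLinearMap.proj i

theorem chOutCLM_apply {m n : ℕ} (P : Matrix (Fin m) (Fin n) ℝ) (j : Fin n) (v : Fin m → ℝ) :
    chOutCLM P j v = chOut P v j := by
  simp [chOutCLM, chOut, mul_comm]

/-- The derivative of `λ ↦ D(P^k‖λΦ)`. -/
def chKLDeriv {m n : ℕ} (P : Matrix (Fin m) (Fin n) ℝ) (l : Fin m → ℝ) (k : Fin m) :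
    (Fin m → ℝ) →L[ℝ] ℝ :=
  ∑ j, (-(P k j / chOut P l j)) • chOutCLM P j

theorem chKLDeriv_apply {m n : ℕ} (P : Matrix (Fin m) (Fin n) ℝ) (l v : Fin m → ℝ)
    (k : Fin m) :
    chKLDeriv P l k v = -∑ j, P k j / chOut P l j * chOut P v j := by
  simp [chKLDeriv, chOutCLM_apply]

theorem hasFDerivAt_chKL {m n : ℕ} (P : Matrix (Fin m) (Fin n) ℝ) {l : Fin m → ℝ}
    (hl : ∀ j, 0 < chOut P l j) (k : Fin m) :
    HasFDerivAt (fun x => chKL (P k) (chOut P x)) (chKLDeriv P l k) l := by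
  unfold chKL chKLDeriv
  refine HasFDerivAt.fun_sum fun j _ => ?_
  have hout : HasFDerivAt (fun x => chOut P x j) (chOutCLM P j) l := by
    rw [← funext (chOutCLM_apply P j)]
    exact (chOutCLM P j).hasFDerivAt
  by_cases hp : P k j = 0
  · simpa [hp] using hasFDerivAt_const (0 : ℝ) l
  · have hq : chOut P l j ≠ 0 := (hl j).ne'
    have h := ((hasDerivAt_const (chOut P l j) (P k j)).div (hasDerivAt_id _) hq).log
      (div_ne_zero hp hq)
    have h2 := (h.const_mul (P k j)).comp_hasFDerivAt l hout
    refine h2.congr_fderiv ?_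
    congr 1
    simp only [id, Pi.div_apply]
    field_simp
    ring

theorem sum_chOut {m n : ℕ} {P : Matrix (Fin m) (Fin n) ℝ} (hP : ∀ i, ∑ j, P i j = 1)
    (v : Fin m → ℝ) : ∑ j, chOut P v j = ∑ i, v i := by
  unfold chOut
  rw [Finset.sum_comm]
  simp [← Finset.mul_sum, hP]

theorem sum_mul_chKLDeriv {m n : ℕ} {P : Matrix (Fin m) (Fin n) ℝ}
    (hP : ∀ i, ∑ j, P i j = 1) {l : Fin m → ℝ} (hl : ∀ j, 0 < chOut P l j) (v : Fin m → ℝ) :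
    ∑ k, l k * chKLDeriv P l k v = -∑ i, v i := by
  simp only [chKLDeriv_apply, mul_neg, Finset.sum_neg_distrib, Finset.mul_sum]
  rw [Finset.sum_comm, ← sum_chOut hP]
  congr 1
  refine Finset.sum_congr rfl fun j _ => ?_
  calc ∑ k, l k * (P k j / chOut P l j * chOut P v j)
      = chOut P l j * (chOut P v j / chOut P l j) := by
        rw [chOut, Finset.sum_mul]
        refine Finset.sum_congr rfl fun k _ => ?_
        rw [← chOut]
        ring
    _ = chOut P v j := mul_div_cancel₀ _ (hl j).ne'

theorem chMI_eq_sum_chKL {m n : ℕ} (P : Matrix (Fin m) (Fin n) ℝ) (l : Fin m → ℝ) :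
    chMI P l = ∑ i, l i * chKL (P i) (chOut P l) := by
  simp only [chMI, chKL, Finset.mul_sum, mul_assoc]

theorem hasFDerivAt_chMI {m n : ℕ} (P : Matrix (Fin m) (Fin n) ℝ) {l : Fin m → ℝ}
    (hl : ∀ j, 0 < chOut P l j) :
    HasFDerivAt (chMI P) (∑ i, (l i • chKLDeriv P l i +
      chKL (P i) (chOut P l) • ContinuousLinearMap.proj i)) l := by
  rw [funext (chMI_eq_sum_chKL P)]
  exact HasFDerivAt.fun_sum fun i _ => (hasFDerivAt_apply i l).mul (hasFDerivAt_chKL P hl i)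

/-- The Kuhn–Tucker condition on the support of a capacity-achieving distribution. -/
theorem chKL_eq_of_chMI_max {m n : ℕ} {P : Matrix (Fin m) (Fin n) ℝ}
    (hP : ∀ i, ∑ j, P i j = 1) {C : ℝ} (hub : ∀ l ∈ chSimplex m, chMI P l ≤ C)
    {l : Fin m → ℝ} (hls : l ∈ chSimplex m) (hach : chMI P l = C)
    (hl : ∀ j, 0 < chOut P l j) {a : Fin m} (ha : 0 < l a) :
    chKL (P a) (chOut P l) = C := by
  set v : Fin m → ℝ := Pi.single a 1 - l with hv
  have hvsum : ∑ i, v i = 0 := by simp [hv, hls.2]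
  have hline : HasDerivAt (fun t : ℝ => l + t • v) v 0 := by
    simpa using ((hasDerivAt_id (0 : ℝ)).smul_const v).const_add l
  have hMI : HasFDerivAt (chMI P) (∑ i, (l i • chKLDeriv P l i +
      chKL (P i) (chOut P l) • ContinuousLinearMap.proj i)) (l + (0 : ℝ) • v) := by
    simpa using hasFDerivAt_chMI P hl
  have hderiv := hMI.comp_hasDerivAt (0 : ℝ) hline
  have hmem : ∀ᶠ t : ℝ in nhds 0, l + t • v ∈ chSimplex m := by
    have hpos : ∀ᶠ t : ℝ in nhds 0, 0 < l a + t * (1 - l a) := by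
      have hc : Continuous fun t : ℝ => l a + t * (1 - l a) := by fun_prop
      exact hc.continuousAt.eventually_const_lt (by simpa using ha)
    filter_upwards [hpos, eventually_lt_nhds (zero_lt_one (α := ℝ))] with t ht ht1
    refine ⟨fun i => ?_, ?_⟩
    · by_cases hi : i = a
      · subst hi
        simpa [hv] using ht.le
      · have := mul_nonneg (sub_nonneg.2 ht1.le) (hls.1 i)
        simp [hv, hi]
        linarith
    · simp [Finset.sum_add_distrib, ← Finset.mul_sum, hvsum, hls.2]
  have hmax : IsLocalMax (chMI P ∘ fun t : ℝ => l + t • v) 0 := by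
    filter_upwards [hmem] with t ht
    simpa [hach] using hub _ ht
  have hzero := hmax.hasDerivAt_eq_zero hderiv
  simp only [sum_apply, add_apply,
    smul_apply, ContinuousLinearMap.proj_apply, smul_eq_mul,
    Finset.sum_add_distrib, sum_mul_chKLDeriv hP hl, hvsum] at hzero
  have hval : ∑ i, chKL (P i) (chOut P l) * v i = chKL (P a) (chOut P l) - C := by
    rw [← hach, chMI_eq_sum_chKL]
    simp [hv, mul_sub, Pi.single_apply, mul_comm]
  linarith

/-- **Theorem 1.** The entries of the Jacobian matrix of the Arimoto map at
the capacity-achieving distribution `λ*`: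
`∂F_i/∂λ_{i'}(λ*) = e^{D*_i − C}(δ_{i'i} + λ*_i D*_{i',i}) + λ*_i (1 − e^{D*_{i'} − C})`. -/
theorem stmt_5 (m n : ℕ) (P : Matrix (Fin m) (Fin n) ℝ)
    (hPnn : ∀ i j, 0 ≤ P i j) (hProw : ∀ i, ∑ j, P i j = 1)
    (hPcol : ∀ j, ∃ i, 0 < P i j)
    (C : ℝ) (hub : ∀ l ∈ chSimplex m, chMI P l ≤ C)
    (lstar : Fin m → ℝ) (hls : lstar ∈ chSimplex m) (hach : chMI P lstar = C)
    (hQpos : ∀ j, 0 < chOut P lstar j)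
    (D2 : Fin m → Fin m → ℝ)
    (hD2 : ∀ i' i, D2 i' i = -∑ j, P i' j * P i j / chOut P lstar j)
    (i' i : Fin m) :
    chPd (fun x => chAF P x i) i' lstar
      = Real.exp (chKL (P i) (chOut P lstar) - C)
          * ((if i' = i then (1 : ℝ) else 0) + lstar i * D2 i' i)
        + lstar i * (1 - Real.exp (chKL (P i') (chOut P lstar) - C)) := by
  set D : Fin m → ℝ := fun k => chKL (P k) (chOut P lstar) with hD
  have hexp : ∀ k, lstar k * Real.exp (D k) = lstar k * Real.exp C := fun k => by
    rcases (hls.1 k).eq_or_lt with h | h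
    · simp [← h]
    · rw [show D k = C from chKL_eq_of_chMI_max hProw hub hls hach hQpos h]
  have hS : ∑ k, lstar k * Real.exp (D k) = Real.exp C := by
    simp [hexp, ← Finset.sum_mul, hls.2]
  have hN : ∀ k, HasFDerivAt (fun x : Fin m → ℝ => x k * Real.exp (chKL (P k) (chOut P x)))
      (lstar k • Real.exp (D k) • chKLDeriv P lstar k +
        Real.exp (D k) • ContinuousLinearMap.proj k) lstar := fun k =>
    (hasFDerivAt_apply k lstar).mul (hasFDerivAt_chKL P hQpos k).exp
  have hF := (hN i).fun_mul ((hasDerivAt_inv (hS.trans_ne (Real.exp_ne_zero C))).comp_hasFDerivAt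
    lstar (HasFDerivAt.fun_sum fun k (_ : k ∈ Finset.univ) => hN k))
  have hK : ∀ k, chKLDeriv P lstar k (Pi.single i' 1) = D2 i' k := fun k => by
    rw [chKLDeriv_apply, hD2]
    congr 1
    refine Finset.sum_congr rfl fun j _ => ?_
    have : chOut P (Pi.single i' 1) j = P i' j := by simp [chOut, Pi.single_apply]
    rw [this]
    ring
  have hsum : ∑ k, lstar k * (Real.exp (D k) * D2 i' k) = -Real.exp C := by
    have h := sum_mul_chKLDeriv hProw hQpos (Pi.single i' 1)
    simp only [hK, Finset.sum_pi_single', Finset.mem_univ, if_true] at h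
    calc ∑ k, lstar k * (Real.exp (D k) * D2 i' k)
        = Real.exp C * ∑ k, lstar k * D2 i' k := by
          rw [Finset.mul_sum]
          refine Finset.sum_congr rfl fun k _ => ?_
          rw [← mul_assoc, hexp]
          ring
      _ = -Real.exp C := by rw [h]; simp
  have hsingle : ∑ k, Real.exp (D k) * (Pi.single i' 1 : Fin m → ℝ) k = Real.exp (D i') := by
    simp [Pi.single_apply]
  have hdelta : (Pi.single i' 1 : Fin m → ℝ) i = if i' = i then 1 else 0 := by
    simp [Pi.single_apply, eq_comm]
  simp only [chPd, chAF, div_eq_mul_inv]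
  refine (DFunLike.congr_fun hF.fderiv _).trans ?_
  change _ = Real.exp (D i - C) * _ + lstar i * (1 - Real.exp (D i' - C))
  simp only [sum_apply, add_apply, smul_apply, ContinuousLinearMap.proj_apply, smul_eq_mul,
    Finset.sum_add_distrib, hK, hsum, hsingle, hdelta]
  change lstar i * Real.exp (D i) * _ + (∑ k, lstar k * Real.exp (D k))⁻¹ * _ = _
  rw [hS, hexp, Real.exp_sub, Real.exp_sub]
  field_simp
  ring
end
end
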